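/- For the Gaussian-kernel pre-activation matrix C_{ih} with entries (C_{ih})_{kj} = −‖X_{ik·} W^Q_h − X_{ij·} W^K_h‖²/(2√d), the map W^Q_h ↦ C_{ih} is Fréchet differentiable and its differential satisfies ‖dC_{ih}‖_F ≤ √(2n/d) ‖X_i‖_F² √(σ_max²(W^Q_h) + σ_max²(W^K_h)) ‖dW^Q_h‖_F for every perturbation dW^Q_h. -/

import Mathlib

open scoped BigOperators
open scoped Matrix

noncomputable section

namespace Paper

/-- Euclidean (`ℓ²`) norm of a finite family of reals. -/
def enorm {ι : Type*} [Fintype ι] (v : ι → ℝ) : ℝ := Real.sqrt (∑ i, v i ^ 2)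

/-- Frobenius norm of a real matrix. -/
def frob {m k : Type*} [Fintype m] [Fintype k] (A : Matrix m k ℝ) : ℝ :=
  Real.sqrt (∑ i, ∑ j, A i j ^ 2)

/-- Largest singular value of a real matrix: `sup` of `‖A v‖₂` over unit vectors `v`. -/
def sigmaMax {m k : Type*} [Fintype m] [Fintype k] (A : Matrix m k ℝ) : ℝ :=
  sSup {c | ∃ v : k → ℝ, (∑ j, v j ^ 2) = 1 ∧ c = enorm (A.mulVec v)}

/-- Smallest singular value of a (full row rank) real matrix:
`inf` of `‖uᵀ A‖₂` over unit vectors `u`. -/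
def sigmaMin {m k : Type*} [Fintype m] [Fintype k] (A : Matrix m k ℝ) : ℝ :=
  sInf {c | ∃ u : m → ℝ, (∑ i, u i ^ 2) = 1 ∧ c = enorm (Matrix.vecMul u A)}

variable {N n D d H : ℕ}

/-- Attention logits `C = X W^Q (X W^K)ᵀ / √d`. -/
def attnC (WQ WK : Matrix (Fin D) (Fin d) ℝ) (Xi : Matrix (Fin n) (Fin D) ℝ) :
    Matrix (Fin n) (Fin n) ℝ :=
  (Real.sqrt (d : ℝ))⁻¹ • (Xi * WQ * (Xi * WK)ᵀ)

/-- Row-wise softmax of a square matrix. -/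
def softmaxMat (Z : Matrix (Fin n) (Fin n) ℝ) : Matrix (Fin n) (Fin n) ℝ :=
  Matrix.of fun k j => Real.exp (Z k j) / ∑ l, Real.exp (Z k l)

/-- Softmax attention kernel. -/
def Ssoft (WQ WK : Matrix (Fin D) (Fin d) ℝ) (Xi : Matrix (Fin n) (Fin D) ℝ) :
    Matrix (Fin n) (Fin n) ℝ :=
  softmaxMat (attnC WQ WK Xi)

/-- Gaussian attention kernel. -/
def Sgauss (WQ WK : Matrix (Fin D) (Fin d) ℝ) (Xi : Matrix (Fin n) (Fin D) ℝ) :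
    Matrix (Fin n) (Fin n) ℝ :=
  Matrix.of fun k j =>
    Real.exp (-(∑ l, (Matrix.vecMul (Xi k) WQ l - Matrix.vecMul (Xi j) WK l) ^ 2) /
      (2 * Real.sqrt (d : ℝ)))

/-- Multi-head attention output on one sample, for given head kernels `S h`. -/
def MH (S : Fin H → Matrix (Fin n) (Fin n) ℝ) (WV : Fin H → Matrix (Fin D) (Fin d) ℝ)
    (WO : Fin H → Fin d → ℝ) (Xi : Matrix (Fin n) (Fin D) ℝ) : Fin n → ℝ :=
  fun k => ∑ h, ∑ l, (S h * Xi * WV h) k l * WO h l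

/-- Squared-error loss `½ Σᵢ ‖out i − y i‖²`. -/
def lossOf (out y : Fin N → Fin n → ℝ) : ℝ :=
  (1 / 2) * ∑ i, ∑ k, (out i k - y i k) ^ 2

/-- The stacked matrix `B ∈ ℝ^{Nn × HD}` whose `(i,h)` block is `S_{ih} X_i`. -/
def Bmat (S : Fin N → Fin H → Matrix (Fin n) (Fin n) ℝ)
    (X : Fin N → Matrix (Fin n) (Fin D) ℝ) :
    Matrix (Fin N × Fin n) (Fin H × Fin D) ℝ :=
  Matrix.of fun ik hp => (S ik.1 hp.1 * X ik.1) ik.2 hp.2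

/-- Block-diagonal stacked value matrix `W^V = diag(W^V_1, …, W^V_H)`. -/
def diagWV (WV : Fin H → Matrix (Fin D) (Fin d) ℝ) :
    Matrix (Fin H × Fin D) (Fin H × Fin d) ℝ :=
  Matrix.of fun hp hq => if hp.1 = hq.1 then WV hp.1 hp.2 hq.2 else 0

/-- Euclidean norm of the output weight `W^O ∈ ℝ^{Hd×1}`. -/
def WOnorm (WO : Fin H → Fin d → ℝ) : ℝ := enorm fun hl : Fin H × Fin d => WO hl.1 hl.2

/-- Frobenius norm of the row-stacked data matrix `X ∈ ℝ^{Nn×D}`. -/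
def XF (X : Fin N → Matrix (Fin n) (Fin D) ℝ) : ℝ :=
  Real.sqrt (∑ i, ∑ k, ∑ p, X i k p ^ 2)

/-- The `h`-th head matrix of a packed head-indexed parameter vector. -/
def headMat (v : EuclideanSpace ℝ (Fin H × Fin D × Fin d)) (h : Fin H) :
    Matrix (Fin D) (Fin d) ℝ :=
  Matrix.of fun p q => v (h, p, q)

/-- Index type for the full parameter set `M = (W^Q, W^K, W^V)`. -/
abbrev FullIdx (H D d : ℕ) := Fin 3 × Fin H × Fin D × Fin d

/-- Query weights of the packed full parameter vector. -/
def mQ (v : EuclideanSpace ℝ (FullIdx H D d)) (h : Fin H) : Matrix (Fin D) (Fin d) ℝ :=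
  Matrix.of fun p q => v (0, h, p, q)

/-- Key weights of the packed full parameter vector. -/
def mK (v : EuclideanSpace ℝ (FullIdx H D d)) (h : Fin H) : Matrix (Fin D) (Fin d) ℝ :=
  Matrix.of fun p q => v (1, h, p, q)

/-- Value weights of the packed full parameter vector. -/
def mV (v : EuclideanSpace ℝ (FullIdx H D d)) (h : Fin H) : Matrix (Fin D) (Fin d) ℝ :=
  Matrix.of fun p q => v (2, h, p, q)

/-- A packed `D × d` parameter vector as a matrix. -/
def toMat2 {D d : ℕ} (w : EuclideanSpace ℝ (Fin D × Fin d)) : Matrix (Fin D) (Fin d) ℝ :=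
  Matrix.of fun p q => w (p, q)

theorem enorm_sq_aux {ι : Type*} [Fintype ι] (v : ι → ℝ) : enorm v ^ 2 = ∑ i, v i ^ 2 :=
  Real.sq_sqrt (Finset.sum_nonneg fun i _ => sq_nonneg _)

theorem sum_mulVec_sq_le {m k : Type*} [Fintype m] [Fintype k] (A : Matrix m k ℝ) (v : k → ℝ) :
    ∑ i, (A.mulVec v i) ^ 2 ≤ (∑ i, ∑ j, A i j ^ 2) * ∑ j, v j ^ 2 := by
  rw [Finset.sum_mul]
  refine Finset.sum_le_sum fun i _ => ?_
  simpa [Matrix.mulVec, dotProduct] using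
    Finset.sum_mul_sq_le_sq_mul_sq Finset.univ (fun j => A i j) v

theorem sum_vecMul_sq_le {m k : Type*} [Fintype m] [Fintype k] (A : Matrix m k ℝ) (u : m → ℝ) :
    ∑ i, (Matrix.vecMul u A i) ^ 2 ≤ (∑ i, u i ^ 2) * (∑ i, ∑ j, A i j ^ 2) := by
  have h := sum_mulVec_sq_le Aᵀ u
  rw [Finset.sum_comm (f := fun i j => A i j ^ 2), mul_comm]
  simpa [Matrix.mulVec_transpose] using h

theorem sigmaMax_bdd {m k : Type*} [Fintype m] [Fintype k] (A : Matrix m k ℝ) :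
    BddAbove {c | ∃ v : k → ℝ, (∑ j, v j ^ 2) = 1 ∧ c = enorm (A.mulVec v)} := by
  refine ⟨Real.sqrt (∑ i, ∑ j, A i j ^ 2), ?_⟩
  rintro c ⟨v, hv, rfl⟩
  refine Real.sqrt_le_sqrt ?_
  simpa [hv] using sum_mulVec_sq_le A v

theorem mulVec_le_sigmaMax {m k : Type*} [Fintype m] [Fintype k] (A : Matrix m k ℝ) (v : k → ℝ) :
    ∑ i, (A.mulVec v i) ^ 2 ≤ sigmaMax A ^ 2 * ∑ j, v j ^ 2 := by
  have hs0 : 0 ≤ ∑ j, v j ^ 2 := Finset.sum_nonneg fun i _ => sq_nonneg _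
  rcases hs0.eq_or_lt with h0 | hpos
  · have h := sum_mulVec_sq_le A v
    rw [← h0] at h ⊢
    simpa using h
  · set r := Real.sqrt (∑ j, v j ^ 2) with hr
    have hrpos : 0 < r := Real.sqrt_pos.2 hpos
    have hr2 : r ^ 2 = ∑ j, v j ^ 2 := Real.sq_sqrt hs0
    have hmem : enorm (A.mulVec (r⁻¹ • v)) ≤ sigmaMax A := by
      refine le_csSup (sigmaMax_bdd A) ⟨r⁻¹ • v, ?_, rfl⟩
      simp only [Pi.smul_apply, smul_eq_mul, mul_pow]
      rw [← Finset.mul_sum, ← hr2]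
      field_simp
    have h2 : enorm (A.mulVec (r⁻¹ • v)) ^ 2 ≤ sigmaMax A ^ 2 :=
      pow_le_pow_left₀ (Real.sqrt_nonneg _) hmem 2
    rw [enorm_sq_aux, Matrix.mulVec_smul] at h2
    simp only [Pi.smul_apply, smul_eq_mul, mul_pow] at h2
    rw [← Finset.mul_sum, inv_pow, inv_mul_le_iff₀ (by positivity)] at h2
    rw [← hr2]
    linarith

theorem vecMul_le_sigmaMax {m k : Type*} [Fintype m] [Fintype k] (A : Matrix m k ℝ) (u : m → ℝ) :
    ∑ i, (Matrix.vecMul u A i) ^ 2 ≤ sigmaMax A ^ 2 * ∑ j, u j ^ 2 := by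
  set v := Matrix.vecMul u A with hv
  have h1 : ∑ i, v i ^ 2 = ∑ j, u j * (A.mulVec v) j := by
    have : v ⬝ᵥ v = u ⬝ᵥ A.mulVec v := by
      rw [Matrix.dotProduct_mulVec]
    simpa [dotProduct, sq] using this
  have h2 := Finset.sum_mul_sq_le_sq_mul_sq Finset.univ u (A.mulVec v)
  rw [← h1] at h2
  have h3 := mulVec_le_sigmaMax A v
  have hu : 0 ≤ ∑ j, u j ^ 2 := Finset.sum_nonneg fun i _ => sq_nonneg _
  have hs0 : 0 ≤ ∑ j, v j ^ 2 := Finset.sum_nonneg fun i _ => sq_nonneg _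
  rcases hs0.eq_or_lt with h0 | hpos
  · rw [← h0]; positivity
  · have h4 := mul_le_mul_of_nonneg_left h3 hu
    refine le_of_mul_le_mul_right ?_ hpos
    nlinarith

/-- The linear functional `w ↦ (x W)_l`. -/
def rowCLM {D d : ℕ} (x : Fin D → ℝ) (l : Fin d) : EuclideanSpace ℝ (Fin D × Fin d) →L[ℝ] ℝ :=
  LinearMap.toContinuousLinearMap
    { toFun := fun w => Matrix.vecMul x (toMat2 w) l
      map_add' := fun a b => by
        simp [Matrix.vecMul, dotProduct, toMat2, mul_add, Finset.sum_add_distrib]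
      map_smul' := fun c a => by
        simp only [Matrix.vecMul, dotProduct, toMat2, Matrix.of_apply, PiLp.smul_apply,
          smul_eq_mul, RingHom.id_apply, Finset.mul_sum]
        exact Finset.sum_congr rfl fun i _ => by ring }

theorem rowCLM_apply {D d : ℕ} (x : Fin D → ℝ) (l : Fin d)
    (w : EuclideanSpace ℝ (Fin D × Fin d)) :
    rowCLM x l w = Matrix.vecMul x (toMat2 w) l := rfl

theorem comp_hasFDerivAt {D d : ℕ} (x : Fin D → ℝ) (b : Fin d → ℝ) (s : ℝ)
    (w : EuclideanSpace ℝ (Fin D × Fin d)) :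
    ∃ L : EuclideanSpace ℝ (Fin D × Fin d) →L[ℝ] ℝ,
      HasFDerivAt (fun w : EuclideanSpace ℝ (Fin D × Fin d) =>
        -(∑ l, (Matrix.vecMul x (toMat2 w) l - b l) ^ 2) / (2 * s)) L w ∧
      ∀ dw, L dw = -(∑ l, (Matrix.vecMul x (toMat2 w) l - b l) *
        Matrix.vecMul x (toMat2 dw) l) / s := by
  have h1 : ∀ l ∈ (Finset.univ : Finset (Fin d)), HasFDerivAt
      (fun w : EuclideanSpace ℝ (Fin D × Fin d) => (rowCLM x l w - b l) ^ 2)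
      ((2 * (rowCLM x l w - b l)) • rowCLM x l) w := by
    intro l _
    have := (((rowCLM x l).hasFDerivAt (x := w)).sub_const (b l)).pow 2
    simpa using this
  have h2 := (HasFDerivAt.fun_neg (HasFDerivAt.fun_sum h1)).mul_const ((2 * s)⁻¹)
  refine ⟨_, by simpa only [div_eq_mul_inv, rowCLM_apply] using h2, ?_⟩
  intro dw
  simp only [smul_apply, neg_apply,
    sum_apply, smul_eq_mul, rowCLM_apply, mul_assoc]
  rw [← Finset.mul_sum, mul_inv, div_eq_mul_inv]
  ring

theorem entry_bound {D d : ℕ} (x y : Fin D → ℝ) (K W V : Matrix (Fin D) (Fin d) ℝ) :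
    (-(∑ l, (Matrix.vecMul x W l - Matrix.vecMul y K l) * Matrix.vecMul x V l)
      / Real.sqrt d) ^ 2 ≤
    2 / d * (sigmaMax W ^ 2 * (∑ p, x p ^ 2) + sigmaMax K ^ 2 * ∑ p, y p ^ 2) *
      ((∑ p, x p ^ 2) * ∑ i, ∑ j, V i j ^ 2) := by
  rw [div_pow, neg_sq, Real.sq_sqrt (Nat.cast_nonneg d)]
  have h1 := Finset.sum_mul_sq_le_sq_mul_sq Finset.univ
    (fun l => Matrix.vecMul x W l - Matrix.vecMul y K l) (fun l => Matrix.vecMul x V l)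
  have h2 := sum_vecMul_sq_le V x
  have h3 : ∑ l, (Matrix.vecMul x W l - Matrix.vecMul y K l) ^ 2 ≤
      2 * (sigmaMax W ^ 2 * (∑ p, x p ^ 2) + sigmaMax K ^ 2 * ∑ p, y p ^ 2) := by
    have : ∑ l, (Matrix.vecMul x W l - Matrix.vecMul y K l) ^ 2 ≤
        ∑ l, 2 * ((Matrix.vecMul x W l) ^ 2 + (Matrix.vecMul y K l) ^ 2) :=
      Finset.sum_le_sum fun l _ => by
        nlinarith [sq_nonneg (Matrix.vecMul x W l + Matrix.vecMul y K l)]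
    rw [← Finset.mul_sum, Finset.sum_add_distrib] at this
    linarith [vecMul_le_sigmaMax W x, vecMul_le_sigmaMax K y]
  have h4 := h1.trans (mul_le_mul h3 h2 (Finset.sum_nonneg fun i _ => sq_nonneg _)
    ((Finset.sum_nonneg fun i _ => sq_nonneg _).trans h3))
  refine (div_le_div_of_nonneg_right h4 (Nat.cast_nonneg d)).trans (le_of_eq ?_)
  ring

theorem total_bound {n : ℕ} (r : Fin n → ℝ) (hr : ∀ k, 0 ≤ r k) (a b c v : ℝ) (ha : 0 ≤ a)
    (hb : 0 ≤ b) (hc : 0 ≤ c) (hv : 0 ≤ v) :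
    ∑ k, ∑ j, c * (a * r k + b * r j) * (r k * v) ≤ n * c * (∑ k, r k) ^ 2 * (a + b) * v := by
  have e : ∑ k, ∑ j, c * (a * r k + b * r j) * (r k * v) =
      c * v * (n * a * ∑ k, r k ^ 2 + b * (∑ k, r k) ^ 2) := by
    have : ∀ k, ∑ j, c * (a * r k + b * r j) * (r k * v) =
        c * v * (n * a) * r k ^ 2 + c * v * b * (∑ j, r j) * r k := by
      intro k
      rw [← Finset.sum_mul, ← Finset.mul_sum, Finset.sum_add_distrib, ← Finset.mul_sum _ (fun j => r j) b]
      simp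
      ring
    simp only [this, Finset.sum_add_distrib, ← Finset.mul_sum]
    ring
  rw [e]
  have h1 : ∑ k, r k ^ 2 ≤ (∑ k, r k) ^ 2 :=
    Finset.sum_sq_le_sq_sum_of_nonneg fun k _ => hr k
  have h2 : (∑ k, r k) ^ 2 ≤ n * (∑ k, r k) ^ 2 := by
    rcases Nat.eq_zero_or_pos n with rfl | hn
    · simp
    · have : (1 : ℝ) ≤ n := by exact_mod_cast hn
      nlinarith [sq_nonneg (∑ k, r k)]
  have h3 : n * a * ∑ k, r k ^ 2 ≤ n * a * (∑ k, r k) ^ 2 :=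
    mul_le_mul_of_nonneg_left h1 (by positivity)
  have h4 := mul_le_mul_of_nonneg_left h2 hb
  have h5 := mul_le_mul_of_nonneg_left (add_le_add h3 h4) (mul_nonneg hc hv)
  refine h5.trans (le_of_eq ?_)
  ring

/-- Lemma 7(1) of the paper. For the Gaussian pre-kernel matrix
`C_{ih}`, the map `W^Q_h ↦ C_{ih}` is (Fréchet) differentiable and
`‖dC_{ih}‖_F ≤ √(2n/d) ‖X_i‖_F² √(σ_max²(W^Q_h) + σ_max²(W^K_h)) ‖dW^Q_h‖_F`. -/
theorem gaussian_preactivation_differential_bound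
    {n D d : ℕ}
    (Xi : Matrix (Fin n) (Fin D) ℝ)
    (WKh : Matrix (Fin D) (Fin d) ℝ)
    (g : EuclideanSpace ℝ (Fin D × Fin d) → EuclideanSpace ℝ (Fin n × Fin n))
    (hg : g = fun w => (EuclideanSpace.equiv (Fin n × Fin n) ℝ).symm
      fun kj => -(∑ l, (Matrix.vecMul (Xi kj.1) (toMat2 w) l -
          Matrix.vecMul (Xi kj.2) WKh l) ^ 2) / (2 * Real.sqrt (d : ℝ))) :
    Differentiable ℝ g ∧
      ∀ (w dw : EuclideanSpace ℝ (Fin D × Fin d)),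
        ‖fderiv ℝ g w dw‖ ≤
          Real.sqrt (2 * n / (d : ℝ)) * frob Xi ^ 2 *
            Real.sqrt (sigmaMax (toMat2 w) ^ 2 + sigmaMax WKh ^ 2) * ‖dw‖ := by
  choose L hL hL2 using fun (w : EuclideanSpace ℝ (Fin D × Fin d)) (kj : Fin n × Fin n) =>
    comp_hasFDerivAt (Xi kj.1) (Matrix.vecMul (Xi kj.2) WKh) (Real.sqrt (d : ℝ)) w
  have hdiff : Differentiable ℝ g := by
    intro w
    rw [differentiableAt_euclidean]
    intro kj
    subst hg
    exact (hL w kj).differentiableAt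
  refine ⟨hdiff, fun w dw => ?_⟩
  have hcomp : ∀ kj, (fderiv ℝ g w dw) kj = L w kj dw := by
    intro kj
    have h1 : HasFDerivAt (fun x => g x kj)
        ((EuclideanSpace.proj (𝕜 := ℝ) kj).comp (fderiv ℝ g w)) w :=
      (EuclideanSpace.proj (𝕜 := ℝ) kj).hasFDerivAt.comp w (hdiff w).hasFDerivAt
    have h2 : HasFDerivAt (fun x => g x kj) (L w kj) w := by
      subst hg
      exact hL w kj
    have h3 := h1.unique h2
    rw [← h3]
    rfl
  have hdw : ‖dw‖ ^ 2 = ∑ i, ∑ j, toMat2 dw i j ^ 2 := by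
    rw [EuclideanSpace.norm_sq_eq, Fintype.sum_prod_type]
    simp [toMat2]
  have hX : frob Xi ^ 2 = ∑ k, ∑ p, Xi k p ^ 2 :=
    Real.sq_sqrt (Finset.sum_nonneg fun i _ => Finset.sum_nonneg fun j _ => sq_nonneg _)
  refine (abs_le_of_sq_le_sq' ?_ (by positivity)).2
  rw [EuclideanSpace.norm_sq_eq, Fintype.sum_prod_type]
  simp only [hcomp, hL2, Real.norm_eq_abs, sq_abs]
  refine (Finset.sum_le_sum fun k _ => Finset.sum_le_sum fun j _ =>
    entry_bound (Xi k) (Xi j) WKh (toMat2 w) (toMat2 dw)).trans ?_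
  refine (total_bound (fun k => ∑ p, Xi k p ^ 2)
    (fun k => Finset.sum_nonneg fun i _ => sq_nonneg _) _ _ _ _ (sq_nonneg _) (sq_nonneg _)
    (by positivity) (by rw [← hdw]; positivity)).trans (le_of_eq ?_)
  rw [mul_pow, mul_pow, mul_pow, Real.sq_sqrt (by positivity), Real.sq_sqrt (by positivity),
    hX, hdw]
  ring

end Paper
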